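/- Let q be a prime power, let d be an even positive integer, and let k = d/2 + 1. Then |R_k| ≥ q^{d+1} - d^{d+2} · q^d, where |R_k| is the cardinality of the range of Z. In particular, for fixed d, |R_k|/q^{d+1} = 1 - O(1/q). -/

import Mathlib

open Finset in
theorem aux_cs {P V : Type*} [Fintype P] [DecidableEq V] (f : P → V) :
    (Fintype.card P) ^ 2 ≤ (univ.image f).card *
      ∑ p : P, ∑ p' : P, (if f p = f p' then 1 else 0) := by
  classical
  have h1 : Fintype.card P = ∑ z ∈ univ.image f, (univ.filter (fun p => f p = z)).card := by
    rw [← Finset.card_univ]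
    exact card_eq_sum_card_image f univ
  have h2 : ∑ p : P, ∑ p' : P, (if f p = f p' then 1 else 0)
      = ∑ z ∈ univ.image f, (univ.filter (fun p => f p = z)).card ^ 2 := by
    have h3 : ∀ p : P, ∑ p' : P, (if f p = f p' then 1 else 0)
        = (univ.filter (fun p' => f p' = f p)).card := by
      intro p
      rw [Finset.card_filter]
      exact sum_congr rfl fun x _ => by simp only [eq_comm]
    simp_rw [h3]
    rw [← Finset.sum_fiberwise_of_maps_to (s := univ) (t := univ.image f) (g := f)
      (fun p _ => mem_image_of_mem f (mem_univ p))]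
    refine sum_congr rfl fun z _ => ?_
    rw [sq, ← smul_eq_mul, ← sum_const]
    refine sum_congr rfl fun p hp => ?_
    rw [(mem_filter.1 hp).2]
  rw [h2, h1]
  exact sq_sum_le_card_mul_sum_sq

theorem aux_vand {F ι : Type*} [Field F] [Fintype ι] (d : ℕ) (hc : Fintype.card ι ≤ d + 1)
    (v c : ι → F) (hv : Function.Injective v)
    (h : ∀ j : Fin (d + 1), ∑ i, c i * v i ^ (j : ℕ) = 0) : c = 0 := by
  let e := Fintype.equivFin ι
  have : c ∘ e.symm = 0 := by
    apply Matrix.eq_zero_of_forall_pow_sum_mul_pow_eq_zero (f := v ∘ e.symm)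
      (hv.comp e.symm.injective)
    intro i
    have := h ⟨i, by omega⟩
    rw [← this]
    exact Equiv.sum_comp e.symm (fun x => c x * v x ^ (i : ℕ))
  funext x
  have h2 := congrFun this (e x)
  simpa using h2

open Finset in
theorem aux_count {F : Type*} [Field F] [Fintype F] [DecidableEq F] (d k a : ℕ) (hk : 2 * k = d + 2)
    (e : Fin k × Fin a → F) (he : Function.Injective e) (u u' : Fin k → Fin a)
    (T : Finset (Fin k)) (hT : ∀ i, u i = u' i → i ∈ T) (hT1 : 1 ≤ T.card) :
    ∑ y : Fin k → F, ∑ y' : Fin k → F,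
      (if (fun j : Fin (d + 1) => ∑ i, y i * e (i, u i) ^ (j : ℕ)) =
        (fun j : Fin (d + 1) => ∑ i, y' i * e (i, u' i) ^ (j : ℕ)) then 1 else 0)
      ≤ Fintype.card F ^ T.card := by
  classical
  rw [← Fintype.sum_prod_type' (f := fun y y' : Fin k → F =>
      (if (fun j : Fin (d + 1) => ∑ i, y i * e (i, u i) ^ (j : ℕ)) =
        (fun j : Fin (d + 1) => ∑ i, y' i * e (i, u' i) ^ (j : ℕ)) then 1 else 0)),
    ← Finset.card_filter]
  have hcard : Fintype.card F ^ T.card = (univ : Finset (T → F)).card := by simp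
  rw [hcard]
  refine Finset.card_le_card_of_injOn (fun p i => p.2 i.1) (fun _ _ => mem_coe.2 (mem_univ _)) ?_
  rintro ⟨y, y'⟩ hp ⟨z, z'⟩ hq hpq
  simp only [coe_filter, mem_univ, true_and, Set.mem_ofPred_eq] at hp hq
  have hpq' : ∀ i ∈ T, y' i = z' i := fun i hi => congrFun hpq ⟨i, hi⟩
  have key := aux_vand (F := F) (ι := Fin k ⊕ {i : Fin k // i ∉ T}) d
    (by
      have := Finset.card_le_univ T
      simp only [Fintype.card_sum, Fintype.card_fin, Fintype.card_subtype_compl,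
        Fintype.card_coe] at *
      omega)
    (Sum.elim (fun i => e (i, u i)) (fun i => e (i.1, u' i.1)))
    (Sum.elim (fun i => y i - z i) (fun i => z' i.1 - y' i.1))
    (by
      rintro (i | ⟨i, hi⟩) (j | ⟨j, hj⟩) hij
      · have := he hij
        simp_all
      · have := he hij
        simp only [Prod.mk.injEq] at this
        obtain ⟨rfl, h⟩ := this
        exact absurd (hT _ h) hj
      · have := he hij
        simp only [Prod.mk.injEq] at this
        obtain ⟨rfl, h⟩ := this
        exact absurd (hT _ h.symm) hi
      · have := he hij
        simp_all)
    (by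
      intro j
      have h1 := congrFun hp j
      have h2 := congrFun hq j
      have h3 : ∑ i : {i : Fin k // i ∉ T}, (z' i.1 - y' i.1) * e (i.1, u' i.1) ^ (j : ℕ)
          = ∑ i, (z' i - y' i) * e (i, u' i) ^ (j : ℕ) := by
        rw [← Finset.sum_subtype (univ.filter (fun i => i ∉ T)) (by simp)
          (fun i => (z' i - y' i) * e (i, u' i) ^ (j : ℕ))]
        apply Finset.sum_subset (filter_subset _ _)
        intro i _ hi
        have : i ∈ T := by simpa using hi
        rw [hpq' i this]; simp
      simp only [Fintype.sum_sum_type, Sum.elim_inl, Sum.elim_inr]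
      rw [h3]
      simp only [sub_mul, sum_sub_distrib]
      rw [h1, h2]; ring)
  have hy : y = z := by
    funext i
    exact sub_eq_zero.1 (congrFun key (Sum.inl i))
  have hy' : y' = z' := by
    funext i
    by_cases hi : i ∈ T
    · exact hpq' i hi
    · exact (sub_eq_zero.1 (congrFun key (Sum.inr ⟨i, hi⟩))).symm
  rw [hy, hy']

open Finset in
theorem aux_sum (k a q : ℕ) :
    ∑ u : Fin k → Fin a, ∑ u' : Fin k → Fin a, q ^ (univ.filter (fun i => u i = u' i)).card
      ≤ (a * q + a ^ 2) ^ k := by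
  have h1 : ∀ u : Fin k → Fin a,
      ∑ u' : Fin k → Fin a, q ^ (univ.filter (fun i => u i = u' i)).card ≤ (q + a) ^ k := by
    intro u
    have h2 : ∀ u' : Fin k → Fin a, q ^ (univ.filter (fun i => u i = u' i)).card
        = ∏ i, (if u i = u' i then q else 1) := by
      intro u'
      rw [Finset.prod_ite]; simp
    simp_rw [h2]
    rw [← Fintype.prod_sum (f := fun (i : Fin k) (b : Fin a) => if u i = b then q else 1)]
    calc _ ≤ ∏ i : Fin k, (q + a) := by
          refine Finset.prod_le_prod' fun i _ => ?_
          calc _ ≤ ∑ b : Fin a, ((if u i = b then q else 0) + 1) := by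
                refine sum_le_sum fun b _ => ?_
                split_ifs <;> omega
            _ = _ := by simp [sum_add_distrib]
      _ = _ := by simp
  calc _ ≤ ∑ u : Fin k → Fin a, (q + a) ^ k := sum_le_sum fun u _ => h1 u
    _ = _ := by
      simp only [sum_const, card_univ, Fintype.card_fun, Fintype.card_fin, smul_eq_mul]
      rw [← mul_pow]; ring

open Finset in
theorem aux_main (F : Type*) [Field F] [Fintype F] (d k a : ℕ) (hk : 2 * k = d + 2)
    (ha : k * a ≤ Fintype.card F) :
    (a ^ k * Fintype.card F ^ k) ^ 2 ≤ (Set.range (fun xy : (Fin k → F) × (Fin k → F) =>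
        fun j : Fin (d + 1) => ∑ i, xy.2 i * xy.1 i ^ (j : ℕ))).ncard *
      ((a * Fintype.card F + a ^ 2) ^ k + a ^ (2 * k) * Fintype.card F) := by
  classical
  obtain ⟨e⟩ : Nonempty (Fin k × Fin a ↪ F) :=
    Function.Embedding.nonempty_of_card_le (by simpa using ha)
  let f : (Fin k → Fin a) × (Fin k → F) → (Fin (d + 1) → F) :=
    fun p j => ∑ i, p.2 i * e (i, p.1 i) ^ (j : ℕ)
  have h := aux_cs f
  have hP : Fintype.card ((Fin k → Fin a) × (Fin k → F)) = a ^ k * Fintype.card F ^ k := by simp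
  rw [hP] at h
  refine h.trans (Nat.mul_le_mul ?_ ?_)
  · rw [← Set.ncard_coe_finset]
    refine Set.ncard_le_ncard ?_ (Set.toFinite _)
    intro z hz
    simp only [coe_image, coe_univ, Set.image_univ, Set.mem_range] at hz
    obtain ⟨p, rfl⟩ := hz
    exact ⟨(fun i => e (i, p.1 i), p.2), rfl⟩
  · rw [Fintype.sum_prod_type]
    simp_rw [Fintype.sum_prod_type]
    have hk0 : 0 < k := by omega
    have hq : 0 < Fintype.card F := Fintype.card_pos
    have hb : ∀ u u' : Fin k → Fin a, ∑ y : Fin k → F, ∑ y' : Fin k → F,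
        (if f (u, y) = f (u', y') then 1 else 0) ≤
        Fintype.card F ^ (univ.filter (fun i => u i = u' i)).card + Fintype.card F := by
      intro u u'
      by_cases hT : 1 ≤ (univ.filter (fun i => u i = u' i)).card
      · have := aux_count d k a hk e e.injective u u' _ (fun i hi => by simpa using hi) hT
        exact this.trans (Nat.le_add_right _ _)
      · have hT0 : univ.filter (fun i => u i = u' i) = ∅ := by
          rw [← Finset.card_eq_zero]; omega
        have := aux_count d k a hk e e.injective u u' {⟨0, hk0⟩} (fun i hi => by
          have : i ∈ univ.filter (fun i => u i = u' i) := by simpa using hi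
          rw [hT0] at this
          simp at this) (by simp)
        rw [card_singleton, pow_one] at this
        exact this.trans (Nat.le_add_left _ _)
    calc _ = ∑ u : Fin k → Fin a, ∑ u' : Fin k → Fin a, ∑ y : Fin k → F, ∑ y' : Fin k → F,
        (if f (u, y) = f (u', y') then 1 else 0) := by
          refine sum_congr rfl fun u _ => ?_
          rw [sum_comm]
      _ ≤ ∑ u : Fin k → Fin a, ∑ u' : Fin k → Fin a,
        (Fintype.card F ^ (univ.filter (fun i => u i = u' i)).card + Fintype.card F) :=
          sum_le_sum fun u _ => sum_le_sum fun u' _ => hb u u'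
      _ ≤ _ := by
          simp only [sum_add_distrib]
          refine Nat.add_le_add (aux_sum _ _ _) (le_of_eq ?_)
          simp only [sum_const, card_univ, Fintype.card_fun, Fintype.card_fin, smul_eq_mul]
          ring

/-- Let `q` be a prime power (`F` the finite field with `q` elements),
`d` an even positive integer, and `k = d/2 + 1`.  Then
`|R_k| ≥ q^{d+1} - d^{d+2} · q^d`, where `R_k` is the range of `Z`. -/
theorem stmt_6 (F : Type*) [Field F] [Fintype F] (d k : ℕ)
    (hd : Even d) (hdpos : 0 < d) (hk : k = d / 2 + 1) :
    (Fintype.card F : ℝ) ^ (d + 1) - (d : ℝ) ^ (d + 2) * (Fintype.card F : ℝ) ^ d ≤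
      ((Set.range (fun xy : (Fin k → F) × (Fin k → F) =>
        fun j : Fin (d + 1) => ∑ i, xy.2 i * xy.1 i ^ (j : ℕ))).ncard : ℝ) := by
  have hk2 : 2 * k = d + 2 := by
    obtain ⟨m, rfl⟩ := hd
    omega
  have hd2 : 2 ≤ d := by omega
  have main := fun a ha => aux_main F d k a hk2 ha
  generalize (Set.range (fun xy : (Fin k → F) × (Fin k → F) =>
        fun j : Fin (d + 1) => ∑ i, xy.2 i * xy.1 i ^ (j : ℕ))).ncard = R at main ⊢
  have hq0 : 0 < Fintype.card F := Fintype.card_pos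
  generalize Fintype.card F = q at main hq0 ⊢
  have hqR : (0 : ℝ) < q := by exact_mod_cast hq0
  by_cases hq : q ≤ d ^ (d + 2)
  · have : (q : ℝ) ≤ (d : ℝ) ^ (d + 2) := by exact_mod_cast hq
    have h2 : (q : ℝ) ^ (d + 1) ≤ (d : ℝ) ^ (d + 2) * (q : ℝ) ^ d := by
      rw [pow_succ, mul_comm]
      gcongr
    have : (0 : ℝ) ≤ R := Nat.cast_nonneg _
    linarith
  push Not at hq
  have hkd : k ≤ d := by omega
  have hkk : k * k ≤ q := by
    calc k * k ≤ d * d := Nat.mul_le_mul hkd hkd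
      _ = d ^ 2 := by ring
      _ ≤ d ^ (d + 2) := Nat.pow_le_pow_right hdpos (by omega)
      _ ≤ q := hq.le
  have hk0 : 0 < k := by omega
  obtain ⟨a, haq⟩ : ∃ a, a = q / k := ⟨_, rfl⟩
  have ha1 : k * a ≤ q := by rw [haq]; exact Nat.mul_div_le q k
  have hak : k ≤ a := by rw [haq]; exact (Nat.le_div_iff_mul_le hk0).2 hkk
  have ha2 : q ≤ (k + 1) * a := by
    have := Nat.lt_mul_div_succ q hk0
    rw [← haq] at this
    nlinarith
  have ha0 : 0 < a := by omega
  have hM := main a ha1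
  have hC : (k + 2) ^ k ≤ d ^ (d + 2) := by
    rw [← hk2, pow_mul]
    apply Nat.pow_le_pow_left
    nlinarith
  have hB : (a * q + a ^ 2) ^ k + a ^ (2 * k) * q ≤ a ^ (2 * k) * (q + d ^ (d + 2)) := by
    have : (a * q + a ^ 2) ^ k ≤ a ^ (2 * k) * (k + 2) ^ k := by
      rw [pow_mul, ← mul_pow]
      apply Nat.pow_le_pow_left
      nlinarith
    have := Nat.mul_le_mul_left (a ^ (2 * k)) hC
    linarith
  have hfin : q ^ (d + 2) ≤ R * (q + d ^ (d + 2)) := by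
    have h1 := hM.trans (Nat.mul_le_mul_left R hB)
    have h2 : (a ^ k * q ^ k) ^ 2 = a ^ (2 * k) * q ^ (d + 2) := by
      rw [← hk2]; ring
    rw [h2] at h1
    refine Nat.le_of_mul_le_mul_left (h1.trans (le_of_eq ?_)) (pow_pos ha0 (2 * k))
    ring
  have hfinR : (q : ℝ) ^ (d + 2) ≤ R * (q + (d : ℝ) ^ (d + 2)) := by exact_mod_cast hfin
  have hCR : (0 : ℝ) ≤ (d : ℝ) ^ (d + 2) := by positivity
  generalize (d : ℝ) ^ (d + 2) = C at hfinR hCR ⊢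
  have hpos : 0 < (q : ℝ) + C := by linarith
  refine le_of_mul_le_mul_right (le_trans ?_ hfinR) hpos
  have h3 : 0 ≤ C ^ 2 * (q : ℝ) ^ d := by positivity
  have h4 : ((q : ℝ) ^ (d + 1) - C * (q : ℝ) ^ d) * (q + C)
    = (q : ℝ) ^ (d + 2) - C ^ 2 * (q : ℝ) ^ d := by ring
  linarith
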